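/- (Delta expansion, mixed form.) Let T > 0, k ∈ ℝ, and let W be a random variable with W > 0 almost surely, E[W] < ∞, and E[W^{1/2}·exp(c/W)] < ∞ for every c > 0. Then the function x ↦ E[Bac(T, x, k, √W)] is differentiable on ℝ and its derivative (the option's Delta) equals Δ(x) = N( (x − k)/(√(E[W])·√T) ) + ((x − k)/√(2πT)) · Σ_{n=1}^∞ [1/((n−1)!·(2n−1))] · (−(x − k)²/(2T))^{n−1} · ( E[W^{1/2−n}] − (E[W])^{1/2−n} ), the series converging absolutely. -/

import Mathlib

open MeasureTheory ProbabilityTheory Real NNReal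

/-- Standard normal cumulative distribution function. -/
noncomputable def normalCDF (z : ℝ) : ℝ :=
  ∫ t in Set.Iic z, Real.exp (-t ^ 2 / 2) / Real.sqrt (2 * Real.pi)

/-- Standard normal probability density function. -/
noncomputable def normalPDF (z : ℝ) : ℝ :=
  Real.exp (-z ^ 2 / 2) / Real.sqrt (2 * Real.pi)

/-- Bachelier moneyness. -/
noncomputable def dBac (T x k σ : ℝ) : ℝ := (x - k) / (σ * Real.sqrt T)

/-- Bachelier call price. -/
noncomputable def Bac (T x k σ : ℝ) : ℝ :=
  (x - k) * normalCDF (dBac T x k σ) + σ * Real.sqrt T * normalPDF (dBac T x k σ)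

theorem continuous_normalPDF : Continuous normalPDF := by
  unfold normalPDF
  fun_prop

theorem normalPDF_nonneg (z : ℝ) : 0 ≤ normalPDF z := by
  unfold normalPDF
  positivity

theorem integrable_normalPDF : Integrable normalPDF := by
  have h := (integrable_exp_neg_mul_sq (b := 1 / 2) (by norm_num)).div_const
    (Real.sqrt (2 * Real.pi))
  refine h.congr (Filter.Eventually.of_forall fun t => ?_)
  simp only [normalPDF]
  congr 2
  ring

theorem normalCDF_eq (z : ℝ) : normalCDF z = ∫ t in Set.Iic z, normalPDF t := rfl

theorem normalCDF_sub (a b : ℝ) :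
    normalCDF b - normalCDF a = ∫ t in a..b, normalPDF t :=
  intervalIntegral.integral_Iic_sub_Iic integrable_normalPDF.integrableOn
    integrable_normalPDF.integrableOn

theorem hasDerivAt_normalCDF (z : ℝ) : HasDerivAt normalCDF (normalPDF z) z := by
  have h := (continuous_normalPDF.integral_hasStrictDerivAt 0 z).hasDerivAt.add_const
    (normalCDF 0)
  refine h.congr_of_eventuallyEq (Filter.Eventually.of_forall fun u => ?_)
  have := normalCDF_sub 0 u
  simp only
  linarith

theorem continuous_normalCDF : Continuous normalCDF :=
  continuous_iff_continuousAt.2 fun z => (hasDerivAt_normalCDF z).continuousAt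

theorem abs_normalCDF_le (z : ℝ) : |normalCDF z| ≤ ∫ t, normalPDF t := by
  rw [normalCDF_eq, abs_of_nonneg (integral_nonneg normalPDF_nonneg)]
  exact setIntegral_le_integral integrable_normalPDF
    (Filter.Eventually.of_forall normalPDF_nonneg)

theorem normalPDF_le (z : ℝ) : normalPDF z ≤ 1 / Real.sqrt (2 * Real.pi) := by
  unfold normalPDF
  gcongr
  rw [Real.exp_le_one_iff]
  nlinarith [sq_nonneg z]

theorem hasSum_exp_real (x : ℝ) :
    HasSum (fun n : ℕ => x ^ n / (Nat.factorial n : ℝ)) (Real.exp x) := by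
  rw [Real.exp_eq_exp_ℝ]
  exact NormedSpace.expSeries_div_hasSum_exp x

theorem hasSum_normalCDF (z : ℝ) :
    HasSum (fun n : ℕ => z / Real.sqrt (2 * Real.pi) *
      (1 / ((Nat.factorial n : ℝ) * (2 * ((n : ℝ) + 1) - 1)) * (-z ^ 2 / 2) ^ n))
      (normalCDF z - normalCDF 0) := by
  rw [normalCDF_sub]
  have h := intervalIntegral.hasSum_integral_of_dominated_convergence (μ := volume)
    (a := 0) (b := z) (f := normalPDF)
    (F := fun (n : ℕ) t => (-t ^ 2 / 2) ^ n / (Nat.factorial n : ℝ) / Real.sqrt (2 * Real.pi))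
    (fun n _ => (z ^ 2 / 2) ^ n / (Nat.factorial n : ℝ) / Real.sqrt (2 * Real.pi))
    (fun n => Continuous.aestronglyMeasurable (by fun_prop))
    (fun n => Filter.Eventually.of_forall fun t ht => by
      have hle : |t| ≤ |z| := by
        simpa using Set.abs_sub_left_of_mem_uIcc (Set.uIoc_subset_uIcc ht)
      have hsq : t ^ 2 ≤ z ^ 2 := sq_le_sq.2 hle
      rw [norm_div, norm_div, norm_pow, Real.norm_of_nonneg (Real.sqrt_nonneg _),
        Real.norm_of_nonneg (Nat.cast_nonneg _), neg_div, norm_neg,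
        Real.norm_of_nonneg (by positivity)]
      gcongr)
    (Filter.Eventually.of_forall fun t _ => ((hasSum_exp_real _).div_const _).summable)
    (by simp)
    (Filter.Eventually.of_forall fun t _ => (hasSum_exp_real _).div_const _)
  refine h.congr_fun fun n => ?_
  have hint : ∀ t : ℝ, (-t ^ 2 / 2) ^ n / (Nat.factorial n : ℝ) / Real.sqrt (2 * Real.pi) =
      (-1 / 2) ^ n / (Nat.factorial n : ℝ) / Real.sqrt (2 * Real.pi) * t ^ (2 * n) := by
    intro t
    rw [show -t ^ 2 / 2 = (-1 / 2) * t ^ 2 by ring, mul_pow, ← pow_mul]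
    ring
  simp only [hint]
  rw [intervalIntegral.integral_const_mul, integral_pow,
    show -z ^ 2 / 2 = (-1 / 2) * z ^ 2 by ring, mul_pow, ← pow_mul]
  have hn : (2 * ((n : ℝ) + 1) - 1) ≠ 0 := by
    have : (0 : ℝ) ≤ n := n.cast_nonneg
    linarith
  have hn' : (2 * (n : ℝ) + 1) ≠ 0 := by positivity
  push_cast
  field_simp
  ring

theorem hasDerivAt_Bac {T k σ : ℝ} (hT : 0 < T) (hσ : 0 < σ) (x : ℝ) :
    HasDerivAt (fun y => Bac T y k σ) (normalCDF (dBac T x k σ)) x := by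
  have hs : σ * Real.sqrt T ≠ 0 := by positivity
  have hd : HasDerivAt (fun y => dBac T y k σ) (1 / (σ * Real.sqrt T)) x :=
    ((hasDerivAt_id x).sub_const k).div_const _
  have hp : HasDerivAt normalPDF (-(dBac T x k σ) * normalPDF (dBac T x k σ))
      (dBac T x k σ) := by
    have h := (((hasDerivAt_pow 2 (dBac T x k σ)).neg.div_const 2).exp).div_const
      (Real.sqrt (2 * Real.pi))
    refine h.congr_deriv ?_
    simp only [normalPDF, Pi.neg_apply]
    push_cast
    ring
  have h := (((hasDerivAt_id x).sub_const k).mul ((hasDerivAt_normalCDF _).comp x hd)).add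
    ((hp.comp x hd).const_mul (σ * Real.sqrt T))
  refine h.congr_deriv ?_
  have hx : x - k = dBac T x k σ * (σ * Real.sqrt T) := by
    unfold dBac
    field_simp
  simp only [id, Function.comp_apply]
  rw [hx]
  field_simp
  ring

theorem hasSum_normalCDF_moneyness {T w : ℝ} (hT : 0 < T) (hw : 0 < w) (a : ℝ) :
    HasSum (fun n : ℕ => a / Real.sqrt (2 * Real.pi * T) *
      (1 / ((Nat.factorial n : ℝ) * (2 * ((n : ℝ) + 1) - 1)) *
        (-a ^ 2 / (2 * T)) ^ n * w ^ ((1 : ℝ) / 2 - ((n : ℝ) + 1))))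
      (normalCDF (a / (Real.sqrt w * Real.sqrt T)) - normalCDF 0) := by
  convert hasSum_normalCDF (a / (Real.sqrt w * Real.sqrt T)) using 2 with n
  have hwn : w ^ ((1 : ℝ) / 2 - ((n : ℝ) + 1)) = (Real.sqrt w)⁻¹ * (w ^ n)⁻¹ := by
    rw [show (1 : ℝ) / 2 - ((n : ℝ) + 1) = -(1 / 2) + -(n : ℝ) by ring, Real.rpow_add hw,
      Real.rpow_neg hw.le, Real.rpow_neg hw.le, Real.rpow_natCast, Real.sqrt_eq_rpow]
  have hsq : -(a / (Real.sqrt w * Real.sqrt T)) ^ 2 / 2 = -a ^ 2 / (2 * T) * w⁻¹ := by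
    rw [div_pow, mul_pow, Real.sq_sqrt hw.le, Real.sq_sqrt hT.le]
    field_simp
  rw [hwn, hsq, mul_pow, inv_pow, Real.sqrt_mul (by positivity)]
  field_simp

theorem sum_pow_div_factorial_mul_rpow_le {c w : ℝ} (hc : 0 ≤ c) (hw : 0 < w)
    (u : Finset ℕ) :
    ∑ n ∈ u, c ^ n / (Nat.factorial n : ℝ) * w ^ ((1 : ℝ) / 2 - ((n : ℝ) + 1)) ≤
      w ^ ((1 : ℝ) / 2) * Real.exp ((c + 1) / w) := by
  have hterm : ∀ n : ℕ, c ^ n / (Nat.factorial n : ℝ) * w ^ ((1 : ℝ) / 2 - ((n : ℝ) + 1)) =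
      (c / w) ^ n / (Nat.factorial n : ℝ) * (w ^ ((1 : ℝ) / 2) * w⁻¹) := by
    intro n
    rw [show (1 : ℝ) / 2 - ((n : ℝ) + 1) = 1 / 2 + (-1 + -(n : ℝ)) by ring, Real.rpow_add hw,
      Real.rpow_add hw, Real.rpow_neg hw.le (n : ℝ), Real.rpow_natCast, Real.rpow_neg_one,
      div_pow]
    ring
  simp only [hterm]
  rw [← Finset.sum_mul]
  have h1 : ∑ n ∈ u, (c / w) ^ n / (Nat.factorial n : ℝ) ≤ Real.exp (c / w) :=
    sum_le_hasSum u (fun n _ => by positivity) (hasSum_exp_real _)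
  have h2 : w⁻¹ ≤ Real.exp (1 / w) := by
    have := Real.add_one_le_exp (1 / w)
    rw [one_div] at *
    linarith
  calc _ ≤ Real.exp (c / w) * (w ^ ((1 : ℝ) / 2) * Real.exp (1 / w)) := by gcongr
    _ = _ := by rw [add_div, Real.exp_add]; ring

section Expectation

variable {Ω : Type*} [MeasurableSpace Ω] {P : Measure Ω} {W : Ω → ℝ}

theorem integrable_rpow_half_sub (hW : Measurable W) (hpos : ∀ᵐ ω ∂P, 0 < W ω)
    (hexp : ∀ c : ℝ, 0 < c →
      Integrable (fun ω => W ω ^ ((1 : ℝ) / 2) * Real.exp (c / W ω)) P) (n : ℕ) :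
    Integrable (fun ω => W ω ^ ((1 : ℝ) / 2 - ((n : ℝ) + 1))) P := by
  refine ((hexp (1 + 1) (by norm_num)).const_mul (Nat.factorial n : ℝ)).mono'
    (hW.pow_const _).aestronglyMeasurable ?_
  filter_upwards [hpos] with ω hω
  have h := sum_pow_div_factorial_mul_rpow_le zero_le_one hω {n}
  have hn : (0 : ℝ) < Nat.factorial n := by positivity
  rw [Finset.sum_singleton, one_pow, one_div, inv_mul_le_iff₀ hn] at h
  rwa [Real.norm_of_nonneg (by positivity)]

theorem summable_mul_integral_norm_rpow (hW : Measurable W) (hpos : ∀ᵐ ω ∂P, 0 < W ω)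
    (hexp : ∀ c : ℝ, 0 < c →
      Integrable (fun ω => W ω ^ ((1 : ℝ) / 2) * Real.exp (c / W ω)) P) (b : ℝ) :
    Summable fun n : ℕ => ∫ ω, ‖1 / ((Nat.factorial n : ℝ) * (2 * ((n : ℝ) + 1) - 1)) * b ^ n *
      W ω ^ ((1 : ℝ) / 2 - ((n : ℝ) + 1))‖ ∂P := by
  have hint := integrable_rpow_half_sub hW hpos hexp
  refine summable_of_sum_le (c := ∫ ω, W ω ^ ((1 : ℝ) / 2) * Real.exp ((|b| + 1) / W ω) ∂P)
    (fun n => integral_nonneg fun ω => norm_nonneg _) fun u => ?_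
  rw [← integral_finsetSum _ fun n _ => ((hint n).const_mul _).norm]
  refine integral_mono_ae (integrable_finsetSum _ fun n _ => ((hint n).const_mul _).norm)
    (hexp _ (by positivity)) ?_
  filter_upwards [hpos] with ω hω
  refine le_trans (Finset.sum_le_sum fun n _ => ?_)
    (sum_pow_div_factorial_mul_rpow_le (abs_nonneg b) hω u)
  have hn : (1 : ℝ) ≤ 2 * ((n : ℝ) + 1) - 1 := by
    have : (0 : ℝ) ≤ n := n.cast_nonneg
    linarith
  have hn0 : (0 : ℝ) ≤ 2 * ((n : ℝ) + 1) - 1 := by linarith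
  have hf : (0 : ℝ) < Nat.factorial n := by positivity
  rw [norm_mul, norm_mul, norm_pow, Real.norm_eq_abs b,
    Real.norm_of_nonneg (Real.rpow_nonneg hω.le _), Real.norm_of_nonneg (by positivity),
    div_mul_eq_mul_div, one_mul]
  gcongr
  exact le_mul_of_one_le_right hf.le hn

theorem hasSum_integral_normalCDF_moneyness (hW : Measurable W) (hpos : ∀ᵐ ω ∂P, 0 < W ω)
    (hexp : ∀ c : ℝ, 0 < c →
      Integrable (fun ω => W ω ^ ((1 : ℝ) / 2) * Real.exp (c / W ω)) P)
    {T : ℝ} (hT : 0 < T) (a : ℝ) :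
    ∃ S : ℝ, HasSum (fun n : ℕ => 1 / ((Nat.factorial n : ℝ) * (2 * ((n : ℝ) + 1) - 1)) *
        (-a ^ 2 / (2 * T)) ^ n * ∫ ω, W ω ^ ((1 : ℝ) / 2 - ((n : ℝ) + 1)) ∂P) S ∧
      a / Real.sqrt (2 * Real.pi * T) * S =
        ∫ ω, (normalCDF (a / (Real.sqrt (W ω) * Real.sqrt T)) - normalCDF 0) ∂P := by
  have h := hasSum_integral_of_summable_integral_norm
    (fun n => (integrable_rpow_half_sub hW hpos hexp n).const_mul
      (1 / ((Nat.factorial n : ℝ) * (2 * ((n : ℝ) + 1) - 1)) * (-a ^ 2 / (2 * T)) ^ n))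
    (summable_mul_integral_norm_rpow hW hpos hexp (-a ^ 2 / (2 * T)))
  simp only [integral_const_mul] at h
  refine ⟨_, h, ?_⟩
  rw [← integral_const_mul]
  refine integral_congr_ae ?_
  filter_upwards [hpos] with ω hω
  exact tsum_mul_left.symm.trans (hasSum_normalCDF_moneyness hT hω a).tsum_eq

theorem integrable_sqrt_of_integrable [IsFiniteMeasure P] (hW : Measurable W)
    (hpos : ∀ᵐ ω ∂P, 0 < W ω) (hWint : Integrable W P) :
    Integrable (fun ω => Real.sqrt (W ω)) P := by
  refine (hWint.add (integrable_const (1 : ℝ))).mono' hW.sqrt.aestronglyMeasurable ?_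
  filter_upwards [hpos] with ω hω
  rw [Real.norm_of_nonneg (Real.sqrt_nonneg _)]
  simp only [Pi.add_apply]
  nlinarith [Real.sq_sqrt hω.le, sq_nonneg (Real.sqrt (W ω) - 1), Real.sqrt_nonneg (W ω)]

theorem measurable_dBac_sqrt (hW : Measurable W) (T x k : ℝ) :
    Measurable fun ω => dBac T x k (Real.sqrt (W ω)) := by
  unfold dBac
  fun_prop

theorem integrable_normalCDF_comp [IsFiniteMeasure P] {f : Ω → ℝ} (hf : Measurable f) :
    Integrable (fun ω => normalCDF (f ω)) P :=
  (integrable_const (∫ t, normalPDF t)).mono'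
    (continuous_normalCDF.measurable.comp hf).aestronglyMeasurable
    (Filter.Eventually.of_forall fun _ => abs_normalCDF_le _)

theorem measurable_Bac_sqrt (hW : Measurable W) (T x k : ℝ) :
    Measurable fun ω => Bac T x k (Real.sqrt (W ω)) := by
  have hd := measurable_dBac_sqrt hW T x k
  exact ((continuous_normalCDF.measurable.comp hd).const_mul _).add
    ((hW.sqrt.mul_const _).mul (continuous_normalPDF.measurable.comp hd))

theorem integrable_Bac_sqrt [IsFiniteMeasure P] (hW : Measurable W)
    (hpos : ∀ᵐ ω ∂P, 0 < W ω) (hWint : Integrable W P) (T x k : ℝ) :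
    Integrable (fun ω => Bac T x k (Real.sqrt (W ω))) P := by
  have hd := measurable_dBac_sqrt hW T x k
  refine ((integrable_normalCDF_comp hd).const_mul (x - k)).add
    (((integrable_sqrt_of_integrable hW hpos hWint).mul_const _).mul_bdd
      (c := 1 / Real.sqrt (2 * Real.pi))
      (continuous_normalPDF.measurable.comp hd).aestronglyMeasurable
      (Filter.Eventually.of_forall fun ω => ?_))
  rw [Real.norm_of_nonneg (normalPDF_nonneg _)]
  exact normalPDF_le _

theorem hasDerivAt_integral_Bac [IsFiniteMeasure P] (hW : Measurable W)
    (hpos : ∀ᵐ ω ∂P, 0 < W ω) (hWint : Integrable W P) {T : ℝ} (hT : 0 < T) (k x : ℝ) :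
    HasDerivAt (fun y => ∫ ω, Bac T y k (Real.sqrt (W ω)) ∂P)
      (∫ ω, normalCDF (dBac T x k (Real.sqrt (W ω))) ∂P) x := by
  refine (hasDerivAt_integral_of_dominated_loc_of_deriv_le
    (F' := fun y ω => normalCDF (dBac T y k (Real.sqrt (W ω))))
    (bound := fun _ => ∫ t, normalPDF t) (s := Set.univ) Filter.univ_mem
    (Filter.Eventually.of_forall fun y => (measurable_Bac_sqrt hW T y k).aestronglyMeasurable)
    (integrable_Bac_sqrt hW hpos hWint T x k)
    (integrable_normalCDF_comp (measurable_dBac_sqrt hW T x k)).aestronglyMeasurable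
    (Filter.Eventually.of_forall fun ω y _ => abs_normalCDF_le _) (integrable_const _) ?_).2
  filter_upwards [hpos] with ω hω y _
  exact hasDerivAt_Bac hT (Real.sqrt_pos.2 hω) y

end Expectation

/-- Delta expansion (mixed form): `x ↦ E[Bac(T,x,k,√W)]` is differentiable and
its derivative equals
`Δ(x) = N((x−k)/(√E[W]·√T)) + ((x−k)/√(2πT)) Σ_{n≥1} [1/((n−1)!(2n−1))]
  (−(x−k)²/(2T))^{n−1} (E[W^{1/2−n}] − (E[W])^{1/2−n})`,
the series (indexed below by `n+1`) converging absolutely. -/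
theorem bachelier_delta_expansion_mixed
    {Ω : Type*} [MeasurableSpace Ω] (P : Measure Ω) [IsProbabilityMeasure P]
    (T k : ℝ) (hT : 0 < T)
    (W : Ω → ℝ) (hW : Measurable W) (hpos : ∀ᵐ ω ∂P, 0 < W ω)
    (hWint : Integrable W P)
    (hexp : ∀ c : ℝ, 0 < c →
      Integrable (fun ω => W ω ^ ((1 : ℝ) / 2) * Real.exp (c / W ω)) P) :
    ∀ x : ℝ,
      (Summable fun n : ℕ =>
        |1 / ((Nat.factorial n : ℝ) * (2 * ((n : ℝ) + 1) - 1)) *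
          (-(x - k) ^ 2 / (2 * T)) ^ n *
          ((∫ ω, W ω ^ ((1 : ℝ) / 2 - ((n : ℝ) + 1)) ∂P)
            - (∫ ω, W ω ∂P) ^ ((1 : ℝ) / 2 - ((n : ℝ) + 1)))|) ∧
      HasDerivAt (fun y => ∫ ω, Bac T y k (Real.sqrt (W ω)) ∂P)
        (normalCDF ((x - k) / (Real.sqrt (∫ ω, W ω ∂P) * Real.sqrt T))
          + (x - k) / Real.sqrt (2 * Real.pi * T) *
            ∑' n : ℕ, 1 / ((Nat.factorial n : ℝ) * (2 * ((n : ℝ) + 1) - 1)) *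
              (-(x - k) ^ 2 / (2 * T)) ^ n *
              ((∫ ω, W ω ^ ((1 : ℝ) / 2 - ((n : ℝ) + 1)) ∂P)
                - (∫ ω, W ω ∂P) ^ ((1 : ℝ) / 2 - ((n : ℝ) + 1)))) x := by
  intro x
  have hm : 0 < ∫ ω, W ω ∂P := by
    rw [integral_pos_iff_support_of_nonneg_ae (hpos.mono fun ω hω => hω.le) hWint]
    have hsupp : Function.support W =ᵐ[P] Set.univ := by
      filter_upwards [hpos] with ω hω
      exact propext ⟨fun _ => trivial, fun _ => hω.ne'⟩
    rw [measure_congr hsupp, measure_univ]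
    exact one_pos
  set m := ∫ ω, W ω ∂P
  obtain ⟨S, hS, hSeq⟩ := hasSum_integral_normalCDF_moneyness hW hpos hexp hT (x - k)
  obtain ⟨R, hR, hReq⟩ := hasSum_integral_normalCDF_moneyness (P := P) (W := fun _ => m)
    measurable_const (Filter.Eventually.of_forall fun _ => hm)
    (fun c _ => integrable_const _) hT (x - k)
  simp only [integral_const, probReal_univ, one_smul] at hR hReq
  have hdiff := hS.sub hR
  simp only [← mul_sub] at hdiff
  refine ⟨hdiff.summable.abs, ?_⟩
  have hsub : ∫ ω, (normalCDF ((x - k) / (Real.sqrt (W ω) * Real.sqrt T)) - normalCDF 0) ∂P =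
      ∫ ω, normalCDF (dBac T x k (Real.sqrt (W ω))) ∂P - normalCDF 0 := by
    have h := integral_sub (integrable_normalCDF_comp (P := P) (measurable_dBac_sqrt hW T x k))
      (integrable_const (normalCDF 0))
    rwa [integral_const, probReal_univ, one_smul] at h
  rw [hdiff.tsum_eq, mul_sub, hSeq, hReq, hsub]
  refine (hasDerivAt_integral_Bac hW hpos hWint hT k x).congr_deriv ?_
  ring
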